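/- Let L be an algebraic m-distributive multiplicative lattice and let S ⊆ C(L). Then S is a saturated m-system if and only if the subspace P(S) := ⋂_{s ∈ S} D(s) of Spec(L) is compact (in the Zariski topology) and S = S_{P(S)}, where S_{P(S)} := {c ∈ C(L) : c ≰ p for all p ∈ P(S)}. -/

import Mathlib

open CompleteLattice TopologicalSpace

variable {L : Type*} [CompleteLattice L]

/-- An element `p` of a multiplicative lattice is *prime* if `p ≠ 1` and
`x·y ≤ p` implies `x ≤ p` or `y ≤ p`. -/
def PrimeElt (mul : L → L → L) (p : L) : Prop :=
  p ≠ ⊤ ∧ ∀ x y : L, mul x y ≤ p → x ≤ p ∨ y ≤ p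

/-- The prime spectrum of a multiplicative lattice, as a type. -/
abbrev SpecL (mul : L → L → L) : Type _ := {p : L // PrimeElt mul p}

/-- The Zariski-closed set `V(x) = {p ∈ Spec L | x ≤ p}`. -/
def Vset (mul : L → L → L) (x : L) : Set (SpecL mul) := {p : SpecL mul | x ≤ p.1}

/-- The Zariski topology on the prime spectrum: the closed sets are the `V(x)`. -/
instance (mul : L → L → L) : TopologicalSpace (SpecL mul) :=
  generateFrom {U : Set (SpecL mul) | ∃ x : L, U = (Vset mul x)ᶜ}

/-- An *m-system* in a multiplicative lattice: a nonempty set of compact elements such that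
for all `x, y ∈ S` there is `z ∈ S` with `z ≤ x·y`. -/
def IsMSystem (mul : L → L → L) (S : Set L) : Prop :=
  S.Nonempty ∧ (∀ s ∈ S, IsCompactElement s) ∧
    ∀ x ∈ S, ∀ y ∈ S, ∃ z ∈ S, z ≤ mul x y

/-- A set `S` of compact elements is *saturated* if `x ∈ S`, `c` compact and `x ≤ c`
imply `c ∈ S`. -/
def IsSaturated (S : Set L) : Prop :=
  ∀ x ∈ S, ∀ c : L, IsCompactElement c → x ≤ c → c ∈ S

theorem mem_iInter_compl_Vset {mul : L → L → L} {S : Set L} {p : SpecL mul} :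
    p ∈ ⋂ s ∈ S, (Vset mul s)ᶜ ↔ ∀ s ∈ S, ¬ s ≤ p.1 := by
  simp [Vset]

theorem isOpen_compl_Vset (mul : L → L → L) (x : L) : IsOpen (Vset mul x)ᶜ :=
  isOpen_generateFrom_of_mem ⟨x, rfl⟩

/-- The prime separation theorem: an element above no member of an m-system `S` lies below a prime
element above no member of `S`. -/
theorem IsMSystem.exists_primeElt_ge {mul : L → L → L} (hmul : ∀ x y : L, mul x y ≤ x ⊓ y)
    (hdistl : ∀ x y z : L, mul (x ⊔ y) z = mul x z ⊔ mul y z)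
    (hdistr : ∀ x y z : L, mul x (y ⊔ z) = mul x y ⊔ mul x z)
    {S : Set L} (hS : IsMSystem mul S) {a : L} (ha : ∀ s ∈ S, ¬ s ≤ a) :
    ∃ p, PrimeElt mul p ∧ a ≤ p ∧ ∀ s ∈ S, ¬ s ≤ p := by
  obtain ⟨⟨s₀, hs₀⟩, hSC, hSmul⟩ := hS
  obtain ⟨p, hap, hp⟩ := zorn_le_nonempty₀ {x : L | ∀ s ∈ S, ¬ s ≤ x}
    (fun c hc hchain y hy => ⟨sSup c, fun s hs hle => by
      obtain ⟨x, hx, hsx⟩ := hSC s hs c (sSup c) ⟨y, hy⟩ hchain.directedOn (_root_.isLUB_sSup c) hle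
      exact hc hx s hs hsx, fun z hz => le_sSup hz⟩) a ha
  have hmeets : ∀ x, ¬ x ≤ p → ∃ s ∈ S, s ≤ p ⊔ x := fun x hx => by
    by_contra! h
    exact hx (le_sup_right.trans (hp.2 h le_sup_left))
  refine ⟨p, ⟨?_, fun x y hxy => ?_⟩, hap, hp.1⟩
  · rintro rfl
    exact hp.1 s₀ hs₀ le_top
  · by_contra! h
    obtain ⟨s, hs, hsx⟩ := hmeets x h.1
    obtain ⟨t, ht, hty⟩ := hmeets y h.2
    obtain ⟨z, hz, hzst⟩ := hSmul s hs t ht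
    have hleft : mul s t ≤ mul (p ⊔ x) t := by
      rw [← sup_eq_right.2 hsx, hdistl]
      exact le_sup_left
    have hright : mul (p ⊔ x) t ≤ mul (p ⊔ x) (p ⊔ y) := by
      rw [← sup_eq_right.2 hty, hdistr]
      exact le_sup_left
    have hprod : mul (p ⊔ x) (p ⊔ y) ≤ p := by
      rw [hdistr, hdistl p x y]
      exact sup_le ((hmul _ _).trans inf_le_right) (sup_le ((hmul _ _).trans inf_le_left) hxy)
    exact hp.1 z hz (hzst.trans (hleft.trans (hright.trans hprod)))

/-- If a set of compact elements has the property that every element above none of its members lies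
below a point of `⋂ s ∈ S, D(s)`, then this intersection is compact. -/
theorem isCompact_iInter_compl_Vset {mul : L → L → L} {S : Set L}
    (hSC : ∀ s ∈ S, IsCompactElement s)
    (hsep : ∀ a, (∀ s ∈ S, ¬ s ≤ a) → ∃ p, PrimeElt mul p ∧ a ≤ p ∧ ∀ s ∈ S, ¬ s ≤ p) :
    IsCompact (⋂ s ∈ S, (Vset mul s)ᶜ) := by
  classical
  refine isCompact_generateFrom rfl fun P hP hcover => ?_
  let X : Set L := {x | (Vset mul x)ᶜ ∈ P}
  obtain ⟨s, hs, hsX⟩ : ∃ s ∈ S, s ≤ sSup X := by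
    by_contra! h
    obtain ⟨p, hp, hXp, hSp⟩ := hsep _ h
    obtain ⟨U, hU, hpU⟩ := hcover (mem_iInter_compl_Vset.2 hSp : (⟨p, hp⟩ : SpecL mul) ∈ _)
    obtain ⟨x, rfl⟩ := hP hU
    exact hpU (le_trans (le_sSup (show x ∈ X from hU)) hXp)
  obtain ⟨t, htX, hst⟩ :=
    (isCompactElement_iff_exists_le_sSup_of_le_sSup _ s).1 (hSC s hs) X hsX
  refine ⟨(fun x => (Vset mul x)ᶜ) '' (t : Set L), ?_, t.finite_toSet.image _, fun p hp => ?_⟩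
  · rintro _ ⟨x, hx, rfl⟩
    exact htX hx
  · by_contra h
    refine mem_iInter_compl_Vset.1 hp s hs (hst.trans (Finset.sup_le fun x hx => ?_))
    by_contra hxp
    exact h ⟨_, ⟨x, hx, rfl⟩, hxp⟩

/-- In an algebraic lattice, an element `x` whose open set `D(x)` contains a compact set `K` of
primes has a compact element `c` below it such that `D(c)` contains `K`. -/
theorem exists_isCompactElement_le_of_isCompact {mul : L → L → L}
    (halg : ∀ x : L, ∃ s : Set L, (∀ c ∈ s, IsCompactElement c) ∧ x = sSup s)
    {K : Set (SpecL mul)} (hK : IsCompact K) {x : L} (hx : ∀ p ∈ K, ¬ x ≤ p.1) :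
    ∃ c ≤ x, IsCompactElement c ∧ ∀ p ∈ K, ¬ c ≤ p.1 := by
  obtain ⟨A, hA, rfl⟩ := halg x
  obtain ⟨B, hBA, hB, hKB⟩ := hK.elim_finite_subcover_image (b := A)
    (fun c _ => isOpen_compl_Vset mul c) fun p hp => by
      by_contra h
      refine hx p hp (sSup_le fun c hc => ?_)
      by_contra hcp
      exact h (Set.mem_biUnion hc hcp)
  lift B to Finset L using hB
  refine ⟨B.sup id, Finset.sup_le fun c hc => le_sSup (hBA hc),
    isCompactElement_finsetSup B fun c hc => hA c (hBA hc), fun p hp hle => ?_⟩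
  obtain ⟨c, hc, hcp⟩ := Set.mem_iUnion₂.1 (hKB hp)
  exact hcp ((Finset.le_sup (f := id) hc).trans hle)

/-- For `S ⊆ C(L)` in an algebraic m-distributive multiplicative lattice, `S` is a
saturated m-system iff `P(S) := ⋂_{s ∈ S} D(s)` is compact and `S = S_{P(S)}`. -/
theorem saturated_msystem_iff_compact (mul : L → L → L)
    (hmul : ∀ x y : L, mul x y ≤ x ⊓ y)
    (hdistl : ∀ x y z : L, mul (x ⊔ y) z = mul x z ⊔ mul y z)
    (hdistr : ∀ x y z : L, mul x (y ⊔ z) = mul x y ⊔ mul x z)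
    (halg : ∀ x : L, ∃ s : Set L, (∀ c ∈ s, IsCompactElement c) ∧ x = sSup s)
    (S : Set L) (hSC : ∀ s ∈ S, IsCompactElement s) :
    (IsMSystem mul S ∧ IsSaturated S) ↔
      (IsCompact (⋂ s ∈ S, (Vset mul s)ᶜ) ∧
        S = {c : L | IsCompactElement c ∧
          ∀ p : SpecL mul, p ∈ (⋂ s ∈ S, (Vset mul s)ᶜ) → ¬ c ≤ p.1}) := by
  constructor
  · rintro ⟨hS, hsat⟩
    have hsep := fun a (ha : ∀ s ∈ S, ¬ s ≤ a) => hS.exists_primeElt_ge hmul hdistl hdistr ha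
    refine ⟨isCompact_iInter_compl_Vset hSC hsep, Set.Subset.antisymm
      (fun c hc => ⟨hSC c hc, fun p hp => mem_iInter_compl_Vset.1 hp c hc⟩) ?_⟩
    rintro c ⟨hc, hcP⟩
    by_contra hcS
    obtain ⟨p, hp, hcp, hSp⟩ := hsep c fun s hs hsc => hcS (hsat s hs c hc hsc)
    exact hcP ⟨p, hp⟩ (mem_iInter_compl_Vset.2 hSp) hcp
  · rintro ⟨hP, hSeq⟩
    have hbelow : ∀ x, (∀ p ∈ ⋂ s ∈ S, (Vset mul s)ᶜ, ¬ x ≤ p.1) → ∃ c ∈ S, c ≤ x := fun x hx => by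
      obtain ⟨c, hcx, hc⟩ := exists_isCompactElement_le_of_isCompact halg hP hx
      exact ⟨c, hSeq.ge hc, hcx⟩
    refine ⟨⟨?_, hSC, fun x hx y hy => hbelow _ fun p hp hxy => ?_⟩, fun x hx c hc hxc =>
      hSeq.ge ⟨hc, fun p hp hcp => mem_iInter_compl_Vset.1 hp x hx (hxc.trans hcp)⟩⟩
    · obtain ⟨c, hc, -⟩ := hbelow ⊤ fun p _ hp => p.2.1 (top_le_iff.1 hp)
      exact ⟨c, hc⟩
    · exact (p.2.2 x y hxy).elim (mem_iInter_compl_Vset.1 hp x hx)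
        (mem_iInter_compl_Vset.1 hp y hy)
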